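/- arXiv:2404.17214 — 2 statements merged into one kernel-verified Lean document; each statement's English description precedes it below -/
import Mathlib

section
/- Let P be the convex hull of characteristic vectors of a nonempty family F of subsets of a finite set E, let w be a weight vector on E, and let e ∈ E be such that F contains sets with and without e. Then there exist vertices x', y' of P with x'_e = 0 minimizing w·x over {x ∈ P : x_e = 0}, and y'_e = 1 minimizing w·x over {x ∈ P : x_e = 1}, such that the segment [x', y'] is an edge (1-dimensional face) of P. -/
/-- The characteristic vector of a finite set `S ⊆ ι`. -/
def chi {ι : Type*} [DecidableEq ι] (S : Finset ι) : ι → ℝ := fun i => if i ∈ S then 1 else 0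

lemma face_aux {ι : Type*} (V : Set (ι → ℝ)) (l : (ι → ℝ) →ₗ[ℝ] ℝ) (m : ℝ)
    (h : ∀ v ∈ V, m ≤ l v) :
    (∀ x ∈ convexHull ℝ V, m ≤ l x) ∧
    IsExtreme ℝ (convexHull ℝ V) (convexHull ℝ {v ∈ V | l v = m}) := by
  have key : convexHull ℝ V ⊆ {x | m ≤ l x ∧ (l x = m → x ∈ convexHull ℝ {v ∈ V | l v = m})} := by
    apply convexHull_min
    · intro v hv
      exact ⟨h v hv, fun h' => subset_convexHull ℝ _ ⟨hv, h'⟩⟩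
    · rintro x ⟨hx, hx'⟩ y ⟨hy, hy'⟩ a b ha hb hab
      have e1 : l (a • x + b • y) = a * l x + b * l y := by simp
      obtain rfl : b = 1 - a := by linarith
      refine ⟨by rw [e1]; nlinarith [mul_le_mul_of_nonneg_left hx ha, mul_le_mul_of_nonneg_left hy hb], ?_⟩
      intro he
      rw [e1] at he
      have h3 := mul_nonneg ha (sub_nonneg.2 hx)
      have h4 := mul_nonneg hb (sub_nonneg.2 hy)
      rcases ha.eq_or_lt with h0 | h0
      · subst h0
        simp only [sub_zero, zero_smul, one_smul, zero_add] at *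
        exact hy' (by linarith)
      rcases hb.eq_or_lt with h5 | h5
      · obtain rfl : a = 1 := by linarith
        simp only [sub_self, zero_smul, one_smul, add_zero] at *
        exact hx' (by linarith)
      have h6 : a * (l x - m) = 0 := by nlinarith
      have h7 : (1 - a) * (l y - m) = 0 := by nlinarith
      have h8 : l x = m := by
        rcases mul_eq_zero.1 h6 with h | h <;> linarith
      have h9 : l y = m := by
        rcases mul_eq_zero.1 h7 with h | h <;> linarith
      exact convex_convexHull ℝ _ (hx' h8) (hy' h9) ha hb hab
  have key2 : convexHull ℝ {v ∈ V | l v = m} ⊆ {x | l x = m} := by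
    apply convexHull_min
    · intro v hv
      exact hv.2
    · intro x hx y hy a b ha hb hab
      simp only [Set.mem_ofPred_eq] at *
      simp only [map_add, map_smul, smul_eq_mul, hx, hy]
      rw [← add_mul, hab, one_mul]
  refine ⟨fun x hx => (key hx).1, convexHull_mono (fun v hv => hv.1), ?_⟩
  rintro x hx y hy z hz ⟨a, b, ha, hb, hab, rfl⟩
  have hz' : l (a • x + b • y) = m := key2 hz
  have e1 : l (a • x + b • y) = a * l x + b * l y := by simp
  rw [e1] at hz'
  have hx1 := (key hx).1
  have hy1 := (key hy).1
  obtain rfl : b = 1 - a := by linarith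
  apply (key hx).2
  have h4 := mul_nonneg hb.le (sub_nonneg.2 hy1)
  have h3 := mul_nonneg ha.le (sub_nonneg.2 hx1)
  have h6 : a * (l x - m) = 0 := by nlinarith
  rcases mul_eq_zero.1 h6 with h | h <;> linarith

lemma step_aux {ι : Type*} [Fintype ι] [DecidableEq ι]
    (F : Set (Finset ι)) (w : ι → ℝ) (e : ι)
    (h1 : ∃ S ∈ F, e ∈ S) (h2 : ∃ S ∈ F, e ∉ S) :
    ∃ (c m : ℝ) (G : Set (Finset ι)), G ⊆ F ∧ (∃ S ∈ G, e ∈ S) ∧ (∃ S ∈ G, e ∉ S) ∧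
      (∀ S ∈ G, ∑ i, w i * chi S i = m + c * chi S e) ∧
      (∀ x ∈ convexHull ℝ (chi '' F), m + c * x e ≤ ∑ i, w i * x i) ∧
      IsExtreme ℝ (convexHull ℝ (chi '' F)) (convexHull ℝ (chi '' G)) := by
  obtain ⟨T, ⟨hT, heT⟩, hTm⟩ := Set.exists_min_image {S | S ∈ F ∧ e ∈ S}
    (fun S => ∑ i, w i * chi S i) (Set.toFinite _) h1
  obtain ⟨R, ⟨hR, heR⟩, hRm⟩ := Set.exists_min_image {S | S ∈ F ∧ e ∉ S}
    (fun S => ∑ i, w i * chi S i) (Set.toFinite _) h2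
  set m := ∑ i, w i * chi R i with hm
  set c := ∑ i, w i * chi T i - m with hc
  let l : (ι → ℝ) →ₗ[ℝ] ℝ := ∑ i, w i • LinearMap.proj i - c • LinearMap.proj e
  have hl : ∀ x, l x = ∑ i, w i * x i - c * x e := by
    intro x; simp [l]
  obtain ⟨A, B⟩ := face_aux (chi '' F) l m (by
    rintro _ ⟨S, hS, rfl⟩
    rw [hl]
    by_cases hs : e ∈ S
    · have := hTm S ⟨hS, hs⟩
      have h3 : chi S e = 1 := by simp [chi, hs]
      rw [h3]; linarith
    · have := hRm S ⟨hS, hs⟩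
      have h3 : chi S e = 0 := by simp [chi, hs]
      rw [h3]; linarith)
  refine ⟨c, m, {S ∈ F | l (chi S) = m}, fun S hS => hS.1, ⟨T, ⟨hT, ?_⟩, heT⟩, ⟨R, ⟨hR, ?_⟩, heR⟩,
    ?_, ?_, ?_⟩
  · have h3 : chi T e = 1 := by simp [chi, heT]
    rw [hl, h3]; linarith
  · have h3 : chi R e = 0 := by simp [chi, heR]
    rw [hl, h3]; linarith
  · rintro S ⟨-, hS⟩
    rw [hl] at hS; linarith
  · intro x hx
    have := A x hx
    rw [hl] at this; linarith
  · convert B using 2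
    ext v
    constructor
    · rintro ⟨S, ⟨hS, hS'⟩, rfl⟩
      exact ⟨⟨S, hS, rfl⟩, hS'⟩
    · rintro ⟨⟨S, hS, rfl⟩, hS'⟩
      exact ⟨S, ⟨hS, hS'⟩, rfl⟩

lemma inj_aux (ι : Type*) [Fintype ι] [DecidableEq ι] :
    ∃ u : ι → ℝ, ∀ S T : Finset ι, ∑ i, u i * chi S i = ∑ i, u i * chi T i → S = T := by
  let f : ι ↪ ℕ := (Fintype.equivFin ι).toEmbedding.trans Fin.valEmbedding
  refine ⟨fun i => 2 ^ f i, fun S T h => ?_⟩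
  have h3 : ∀ S : Finset ι, ∑ i, (2 : ℝ) ^ f i * chi S i = ((∑ k ∈ S.map f, 2 ^ k : ℕ) : ℝ) := by
    intro S
    simp [chi]
  rw [h3, h3] at h
  exact Finset.map_injective f (Finset.geomSum_injective le_rfl (Nat.cast_injective h))

/-- Let `P` be the convex hull of the characteristic vectors of a nonempty
family `F` of subsets of a finite set, `w` a weight vector, and `e` an element such that `F`
contains sets with and without `e`.  Then there are vertices `x'` (with `x' e = 0`) and `y'`
(with `y' e = 1`) minimizing `w · x` over `{x ∈ P | x e = 0}` and `{x ∈ P | x e = 1}`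
respectively, such that the segment `[x', y']` is an edge (a face, of dimension 1 since
`x' ≠ y'`) of `P`. -/
theorem stmt0 {ι : Type*} [Fintype ι] [DecidableEq ι]
    (F : Set (Finset ι)) (w : ι → ℝ) (e : ι)
    (h1 : ∃ S ∈ F, e ∈ S) (h2 : ∃ S ∈ F, e ∉ S) :
    ∃ x' y' : ι → ℝ,
      x' ∈ chi '' F ∧ y' ∈ chi '' F ∧ x' e = 0 ∧ y' e = 1 ∧
      IsLeast {t : ℝ | ∃ x ∈ convexHull ℝ (chi '' F), x e = 0 ∧ t = ∑ i, w i * x i}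
        (∑ i, w i * x' i) ∧
      IsLeast {t : ℝ | ∃ x ∈ convexHull ℝ (chi '' F), x e = 1 ∧ t = ∑ i, w i * x i}
        (∑ i, w i * y' i) ∧
      x' ≠ y' ∧
      IsExtreme ℝ (convexHull ℝ (chi '' F)) (segment ℝ x' y') := by
  obtain ⟨c, m, G, hGF, g1, g2, hG, hF, hE⟩ := step_aux F w e h1 h2
  obtain ⟨u, hu⟩ := inj_aux ι
  obtain ⟨c', m', H, hHG, ⟨T, hT, heT⟩, ⟨R, hR, heR⟩, hH, -, hE'⟩ := step_aux G u e g1 g2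
  have hR0 : chi R e = 0 := by simp [chi, heR]
  have hT1 : chi T e = 1 := by simp [chi, heT]
  have hHe : chi '' H = {chi R, chi T} := by
    rw [← Set.image_pair]
    congr 1
    ext S
    constructor
    · intro hS
      by_cases hs : e ∈ S
      · right
        apply hu
        rw [hH S hS, hH T hT, hT1]
        simp [chi, hs]
      · left
        apply hu
        rw [hH S hS, hH R hR, hR0]
        simp [chi, hs]
    · rintro (rfl | rfl) <;> assumption
  have mR : chi R ∈ chi '' F := ⟨R, hGF (hHG hR), rfl⟩
  have mT : chi T ∈ chi '' F := ⟨T, hGF (hHG hT), rfl⟩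
  refine ⟨chi R, chi T, mR, mT, hR0, hT1,
    ⟨⟨_, subset_convexHull ℝ _ mR, hR0, rfl⟩, ?_⟩,
    ⟨⟨_, subset_convexHull ℝ _ mT, hT1, rfl⟩, ?_⟩, ?_, ?_⟩
  · rintro t ⟨x, hx, hxe, rfl⟩
    have := hF x hx
    rw [hG R (hHG hR), hR0]
    rwa [hxe] at this
  · rintro t ⟨x, hx, hxe, rfl⟩
    have := hF x hx
    rw [hG T (hHG hT), hT1]
    rwa [hxe] at this
  · intro h
    rw [h, hT1] at hR0
    exact one_ne_zero hR0
  · rw [← convexHull_pair, ← hHe]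
    exact hE.trans hE'
end

section
/- In a weighted graph, an edge e is in no minimum spanning tree if and only if w_e > min over cycles C containing e of max over f ∈ C \ {e} of w_f; and e is in every minimum spanning tree if and only if w_e < max over edge cuts C containing e of min over f ∈ C \ {e} of w_f. -/
open scoped Classical in
/-- Total weight of the edges of a graph (used for spanning trees). -/
noncomputable def twt {V : Type*} [Fintype V] [DecidableEq V]
    (w : Sym2 V → ℝ) (T : SimpleGraph V) : ℝ :=
  ∑ e ∈ Finset.univ.filter (fun e => e ∈ T.edgeSet), w e

/-- `T` is a spanning tree of `G`: a subgraph (on the same vertex set) which is a tree. -/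
def IsSpanningTree {V : Type*} (G T : SimpleGraph V) : Prop :=
  T ≤ G ∧ T.IsTree

/-- `T` is a minimum spanning tree of `G` for the weights `w`. -/
def IsMST {V : Type*} [Fintype V] [DecidableEq V]
    (G : SimpleGraph V) (w : Sym2 V → ℝ) (T : SimpleGraph V) : Prop :=
  IsSpanningTree G T ∧ ∀ T', IsSpanningTree G T' → twt w T ≤ twt w T'

/-- The edge cut of `G` determined by a vertex set `D`: the edges of `G` with one endpoint
in `D` and the other outside `D`. -/
def cutEdges {V : Type*} (G : SimpleGraph V) (D : Set V) : Set (Sym2 V) :=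
  {f | f ∈ G.edgeSet ∧ ∃ a b : V, f = s(a, b) ∧ a ∈ D ∧ b ∉ D}

open SimpleGraph in
lemma aux_swap {V : Type*} [Fintype V] [DecidableEq V] {G T : SimpleGraph V} (w : Sym2 V → ℝ)
    (hT : IsSpanningTree G T) {f : Sym2 V} (hf : f ∈ T.edgeSet) {u v : V} (huv : G.Adj u v)
    (hn : ¬ (T.deleteEdges {f}).Reachable u v) (hg : s(u, v) ∉ T.edgeSet) :
    ∃ T', IsSpanningTree G T' ∧ T'.edgeSet = insert s(u, v) (T.edgeSet \ {f}) ∧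
      twt w T' = twt w T - w f + w s(u, v) := by
  classical
  set T' := T.deleteEdges {f} ⊔ edge u v with hT'
  have hE : T'.edgeSet = insert s(u, v) (T.edgeSet \ {f}) := by
    rw [hT', edgeSet_sup, edgeSet_edge_of_ne huv.ne, edgeSet_deleteEdges]
    ext; simp
  have hle : T' ≤ G := by
    rw [← edgeSet_subset_edgeSet, hE]
    rintro x (rfl | hx)
    · exact huv
    · exact edgeSet_subset_edgeSet.2 hT.1 hx.1
  have hac : T'.IsAcyclic := (hT.2.isAcyclic.anti (deleteEdges_le _)).sup_edge_of_not_reachable hn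
  have hGc : G.Connected := hT.2.connected.mono hT.1
  obtain ⟨F, h1, h2, h3⟩ := hGc.exists_isTree_le_of_le_of_isAcyclic hle hac
  have cF := (isTree_iff_connected_and_card.1 h3).2
  have cT := (isTree_iff_connected_and_card.1 hT.2).2
  have cT' : T'.edgeSet.ncard = T.edgeSet.ncard := by
    rw [hE, Set.ncard_insert_of_notMem (by simp [hg]), Set.ncard_sdiff_singleton_add_one hf]
  have hFT : T' = F := by
    rw [← edgeSet_inj]
    apply Set.eq_of_subset_of_ncard_le (edgeSet_subset_edgeSet.2 h1)
    rw [cT', ← Nat.card_coe_set_eq, ← Nat.card_coe_set_eq]; omega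
  refine ⟨T', ⟨hle, hFT ▸ h3⟩, hE, ?_⟩
  have ht : ∀ S : SimpleGraph V, twt w S = ∑ e ∈ S.edgeSet.toFinite.toFinset, w e := by
    intro S
    unfold twt
    apply Finset.sum_congr _ (fun _ _ => rfl)
    ext x; simp
  have : T'.edgeSet.toFinite.toFinset = insert s(u, v) (T.edgeSet.toFinite.toFinset.erase f) := by
    ext x
    simp only [Set.Finite.mem_toFinset, Finset.mem_insert, Finset.mem_erase, hE,
      Set.mem_insert_iff, Set.mem_sdiff, Set.mem_singleton_iff]
    tauto
  rw [ht, ht, this, Finset.sum_insert (fun h => hg (by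
      simpa using (Finset.mem_erase.1 h).2)), Finset.sum_erase_eq_sub (by simpa using hf)]
  ring

open SimpleGraph in
lemma aux_A {V : Type*} [Fintype V] [DecidableEq V] {G T H : SimpleGraph V} (w : Sym2 V → ℝ)
    (hT : IsSpanningTree G T) {a b : V} (he : s(a, b) ∈ T.edgeSet) (hH : H ≤ G)
    (heH : s(a, b) ∉ H.edgeSet) (hr : H.Reachable a b) :
    ∃ f ∈ H.edgeSet, ∃ T', IsSpanningTree G T' ∧ s(a, b) ∉ T'.edgeSet ∧
      twt w T' = twt w T - w s(a, b) + w f := by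
  classical
  obtain ⟨p⟩ := hr
  have hbr : ¬ (T.deleteEdges {s(a, b)}).Reachable a b :=
    isBridge_iff.1 (isAcyclic_iff_forall_isBridge.1 hT.2.isAcyclic he)
  obtain ⟨d, hd, h1, h2⟩ := p.exists_boundary_dart
    {x | (T.deleteEdges {s(a, b)}).Reachable a x} (Reachable.refl _) hbr
  simp only [Set.mem_ofPred_eq] at h1 h2
  have hne : s(d.fst, d.snd) ≠ s(a, b) := by
    intro h; exact heH (h ▸ d.adj)
  have hnr : ¬ (T.deleteEdges {s(a, b)}).Reachable d.fst d.snd := fun h => h2 (h1.trans h)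
  obtain ⟨T', h3, h4, h5⟩ := aux_swap w hT he (hH d.adj) hnr
    (fun h => hnr (Adj.reachable (by rw [deleteEdges_adj]; exact ⟨h, hne⟩)))
  refine ⟨s(d.fst, d.snd), d.adj, T', h3, ?_, h5⟩
  rw [h4]; simp only [Set.mem_insert_iff, not_or]; exact ⟨hne.symm, by simp⟩

open SimpleGraph in
lemma aux_B {V : Type*} [Fintype V] [DecidableEq V] {G T : SimpleGraph V} (w : Sym2 V → ℝ)
    (hT : IsSpanningTree G T) {a b : V} (he : s(a, b) ∉ T.edgeSet) (hG : G.Adj a b)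
    (D : Set V) (ha : a ∈ D) (hb : b ∉ D) :
    ∃ f ∈ cutEdges G D, f ≠ s(a, b) ∧ ∃ T', IsSpanningTree G T' ∧ s(a, b) ∈ T'.edgeSet ∧
      twt w T' = twt w T - w f + w s(a, b) := by
  classical
  obtain ⟨p, hp⟩ := hT.2.connected.exists_isPath a b
  obtain ⟨d, hd, h1, h2⟩ := p.exists_boundary_dart D ha hb
  have hne : s(d.fst, d.snd) ≠ s(a, b) := by
    intro h; exact he (h ▸ d.adj)
  have hnr : ¬ (T.deleteEdges {s(d.fst, d.snd)}).Reachable a b := by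
    intro h
    obtain ⟨q, hq⟩ := h.exists_isPath
    have := (hT.2.existsUnique_path a b).unique hp (hq.mapLe (deleteEdges_le _))
    have hm : s(d.fst, d.snd) ∈ p.edges := by
      rw [Walk.edges]; exact List.mem_map.2 ⟨d, hd, rfl⟩
    rw [this] at hm
    simp only [Walk.edges_mapLe_eq_edges] at hm
    have := q.edges_subset_edgeSet hm
    simp at this
  obtain ⟨T', h3, h4, h5⟩ := aux_swap w hT (f := s(d.fst, d.snd)) d.adj hG hnr he
  refine ⟨s(d.fst, d.snd), ⟨hT.1 d.adj, _, _, rfl, h1, h2⟩, hne, T', h3, ?_, h5⟩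
  rw [h4]; simp

open SimpleGraph in
lemma aux_ex {V : Type*} [Fintype V] [DecidableEq V] {G : SimpleGraph V} (w : Sym2 V → ℝ)
    (hG : G.Connected) : ∃ T, IsMST G w T := by
  classical
  obtain ⟨T0, h, h'⟩ := hG.exists_isTree_le
  obtain ⟨T, hT, hm⟩ := Set.exists_min_image {T | IsSpanningTree G T} (twt w)
    (Set.toFinite _) ⟨T0, h, h'⟩
  exact ⟨T, hT, hm⟩

/-- reachable component is a cut avoiding the edges of `H` -/
lemma aux_cut {V : Type*} {G H : SimpleGraph V} (a : V) {f : Sym2 V}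
    (hf : f ∈ cutEdges G {x | H.Reachable a x}) : f ∉ H.edgeSet := by
  obtain ⟨_, x, y, rfl, hx, hy⟩ := hf
  exact fun h => hy (SimpleGraph.Reachable.trans hx (SimpleGraph.Adj.reachable h))

open SimpleGraph in
lemma aux_red {V : Type*} [Fintype V] [DecidableEq V]
    (G : SimpleGraph V) (hG : G.Connected) (w : Sym2 V → ℝ) (a b : V) (he : G.Adj a b) :
    (∀ T, IsMST G w T → s(a, b) ∉ T.edgeSet) ↔
      (fromEdgeSet {f | f ∈ G.edgeSet ∧ w f < w s(a, b)}).Reachable a b := by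
  set H := fromEdgeSet {f | f ∈ G.edgeSet ∧ w f < w s(a, b)} with hH
  have hE : ∀ f, f ∈ H.edgeSet ↔ f ∈ G.edgeSet ∧ w f < w s(a, b) := by
    intro f
    rw [hH, edgeSet_fromEdgeSet]
    simp only [Set.mem_sdiff, Set.mem_ofPred_eq, and_iff_left_iff_imp]
    exact fun h => not_isDiag_of_mem_edgeSet _ h.1
  constructor
  · intro h
    by_contra hr
    obtain ⟨T, hT⟩ := aux_ex w hG
    obtain ⟨f, hf, -, T', h1, h2, h3⟩ := aux_B w hT.1 (h T hT) he {x | H.Reachable a x}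
      (Reachable.refl _) hr
    have hwf : w s(a, b) ≤ w f := by
      have := aux_cut a hf
      rw [hE] at this
      by_contra hc
      exact this ⟨hf.1, not_le.1 hc⟩
    refine h T' ⟨h1, fun S hS => ?_⟩ h2
    have := hT.2 S hS
    linarith
  · intro hr T hT hm
    obtain ⟨f, hf, T', h1, -, h3⟩ := aux_A w hT.1 hm
      (edgeSet_subset_edgeSet.1 fun f hf => ((hE f).1 hf).1) (by rw [hE]; simp) hr
    have := hT.2 T' h1
    have := ((hE f).1 hf).2
    linarith

open SimpleGraph in
lemma aux_blue {V : Type*} [Fintype V] [DecidableEq V]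
    (G : SimpleGraph V) (hG : G.Connected) (w : Sym2 V → ℝ) (a b : V) (he : G.Adj a b) :
    (∀ T, IsMST G w T → s(a, b) ∈ T.edgeSet) ↔
      ∃ D : Set V, s(a, b) ∈ cutEdges G D ∧ ∀ f ∈ cutEdges G D, f ≠ s(a, b) →
        w s(a, b) < w f := by
  constructor
  · intro h
    set H := fromEdgeSet {f | f ∈ G.edgeSet ∧ w f ≤ w s(a, b) ∧ f ≠ s(a, b)} with hH
    have hE : ∀ f, f ∈ H.edgeSet ↔ f ∈ G.edgeSet ∧ w f ≤ w s(a, b) ∧ f ≠ s(a, b) := by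
      intro f
      rw [hH, edgeSet_fromEdgeSet]
      simp only [Set.mem_sdiff, Set.mem_ofPred_eq, and_iff_left_iff_imp]
      exact fun h => not_isDiag_of_mem_edgeSet _ h.1
    have hr : ¬ H.Reachable a b := by
      intro hr
      obtain ⟨T, hT⟩ := aux_ex w hG
      obtain ⟨f, hf, T', h1, h2, h3⟩ := aux_A w hT.1 (h T hT)
        (edgeSet_subset_edgeSet.1 fun f hf => ((hE f).1 hf).1) (by rw [hE]; simp) hr
      refine h2 (h T' ⟨h1, fun S hS => ?_⟩)
      have := hT.2 S hS
      have := ((hE f).1 hf).2.1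
      linarith
    refine ⟨{x | H.Reachable a x}, ⟨he, a, b, rfl, Reachable.refl _, hr⟩, fun f hf hne => ?_⟩
    have := aux_cut a hf
    rw [hE] at this
    by_contra hc
    exact this ⟨hf.1, not_lt.1 hc, hne⟩
  · rintro ⟨D, hD, hlt⟩ T hT
    by_contra hm
    have key : ∃ f ∈ cutEdges G D, f ≠ s(a, b) ∧ ∃ T', IsSpanningTree G T' ∧
        twt w T' = twt w T - w f + w s(a, b) := by
      obtain ⟨-, x, y, hxy, hx, hy⟩ := hD
      rw [hxy] at hm ⊢
      have he' : s(x, y) ∈ G.edgeSet := hxy ▸ he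
      obtain ⟨f, h1, h2, T', h3, -, h4⟩ := aux_B w hT.1 hm he' D hx hy
      exact ⟨f, h1, h2, T', h3, h4⟩
    obtain ⟨f, h1, h2, T', h3, h4⟩ := key
    have := hT.2 T' h3
    have := hlt f h1 h2
    linarith

/-- cycles through `s(a,b)` whose other edges satisfy `P` -/
lemma aux_cycle {V : Type*} (G : SimpleGraph V) (P : Sym2 V → Prop) (a b : V) (he : G.Adj a b)
    (hP : ¬ P s(a, b)) :
    (SimpleGraph.fromEdgeSet {f | f ∈ G.edgeSet ∧ P f}).Reachable a b ↔
    ∃ (v : V) (c : G.Walk v v), c.IsCycle ∧ s(a, b) ∈ c.edges ∧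
      ∀ f ∈ c.edges, f ≠ s(a, b) → P f := by
  set K := SimpleGraph.fromEdgeSet {f | f ∈ G.edgeSet ∧ (P f ∨ f = s(a, b))} with hK
  have hE : ∀ f, f ∈ K.edgeSet ↔ f ∈ G.edgeSet ∧ (P f ∨ f = s(a, b)) := by
    intro f
    rw [hK, SimpleGraph.edgeSet_fromEdgeSet]
    simp only [Set.mem_sdiff, Set.mem_ofPred_eq, and_iff_left_iff_imp]
    exact fun h => SimpleGraph.not_isDiag_of_mem_edgeSet _ h.1
  have hKab : K.Adj a b := (hE s(a, b)).2 ⟨he, Or.inr rfl⟩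
  have hKG : K ≤ G := SimpleGraph.edgeSet_subset_edgeSet.1 fun f hf => ((hE f).1 hf).1
  have hdel : K.deleteEdges {s(a, b)} =
      SimpleGraph.fromEdgeSet {f | f ∈ G.edgeSet ∧ P f} := by
    rw [← SimpleGraph.edgeSet_inj]
    ext f
    rw [SimpleGraph.edgeSet_deleteEdges, Set.mem_sdiff, hE, SimpleGraph.edgeSet_fromEdgeSet]
    simp only [Set.mem_sdiff, Set.mem_ofPred_eq, Set.mem_singleton_iff]
    constructor
    · rintro ⟨⟨h1, h2⟩, h3⟩
      exact ⟨⟨h1, h2.resolve_right h3⟩, SimpleGraph.not_isDiag_of_mem_edgeSet _ h1⟩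
    · rintro ⟨⟨h1, h2⟩, h3⟩
      exact ⟨⟨h1, Or.inl h2⟩, fun h => hP (h ▸ h2)⟩
  have key := SimpleGraph.adj_and_reachable_delete_edges_iff_exists_cycle (G := K) (v := a) (w := b)
  rw [hdel] at key
  constructor
  · intro h
    obtain ⟨u, p, hp, hm⟩ := key.1 ⟨hKab, h⟩
    refine ⟨u, p.mapLe hKG, hp.mapLe hKG, by simpa using hm, fun f hf hne => ?_⟩
    rw [SimpleGraph.Walk.edges_mapLe_eq_edges] at hf
    exact ((hE f).1 (p.edges_subset_edgeSet hf)).2.resolve_right hne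
  · rintro ⟨u, c, hc, hm, hall⟩
    have hcK : ∀ f ∈ c.edges, f ∈ K.edgeSet := by
      intro f hf
      refine (hE f).2 ⟨c.edges_subset_edgeSet hf, ?_⟩
      by_cases h : f = s(a, b)
      · exact Or.inr h
      · exact Or.inl (hall f hf h)
    exact (key.2 ⟨u, c.transfer K hcK, hc.transfer hcK, by simpa using hm⟩).2

/-- (Red and blue rules.)  In a connected weighted graph, a non-bridge
edge `e` is in no minimum spanning tree iff `w e` exceeds the minimum over cycles `C`
containing `e` of the maximum weight of an edge of `C - e`; and `e` is in every minimum
spanning tree iff `w e` is below the maximum over edge cuts `C` containing `e` of the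
minimum weight of an edge of `C - e`. -/
theorem stmt13 {V : Type*} [Fintype V] [DecidableEq V]
    (G : SimpleGraph V) (hG : G.Connected) (w : Sym2 V → ℝ)
    (e : Sym2 V) (he : e ∈ G.edgeSet) (hb : ¬ G.IsBridge e) :
    ((∀ T, IsMST G w T → e ∉ T.edgeSet) ↔
      sInf {t : ℝ | ∃ (v : V) (c : G.Walk v v), c.IsCycle ∧ e ∈ c.edges ∧
        t = sSup (w '' {f | f ∈ c.edges ∧ f ≠ e})} < w e) ∧
    ((∀ T, IsMST G w T → e ∈ T.edgeSet) ↔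
      w e < sSup {t : ℝ | ∃ D : Set V, e ∈ cutEdges G D ∧
        t = sInf (w '' (cutEdges G D \ {e}))}) := by
  classical
  induction e using Sym2.ind with | _ a b => ?_
  have hab : G.Adj a b := he
  constructor
  · rw [aux_red G hG w a b hab, aux_cycle G (fun f => w f < w s(a, b)) a b hab (lt_irrefl _)]
    have hne : ∀ (v : V) (c : G.Walk v v), c.IsCycle → s(a, b) ∈ c.edges →
        {f | f ∈ c.edges ∧ f ≠ s(a, b)}.Nonempty := by
      intro v c hc hm
      by_contra hemp
      have hall : ∀ f ∈ c.edges, f = s(a, b) := by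
        intro f hf; by_contra h; exact hemp ⟨f, hf, h⟩
      have h1 := hc.three_le_length
      have h2 : c.edges.Nodup := hc.isTrail.edges_nodup
      have h3 : c.edges.length ≤ 1 := by
        rw [← List.toFinset_card_of_nodup h2]
        apply Finset.card_le_one.2
        intro x hx y hy
        rw [hall x (by simpa using hx), hall y (by simpa using hy)]
      rw [SimpleGraph.Walk.length_edges] at h3
      omega
    rw [csInf_lt_iff]
    · constructor
      · rintro ⟨v, c, hc, hm, hall⟩
        refine ⟨_, ⟨v, c, hc, hm, rfl⟩, ?_⟩
        rw [Set.Finite.csSup_lt_iff (Set.toFinite _) ((hne v c hc hm).image w)]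
        rintro _ ⟨f, ⟨h1, h2⟩, rfl⟩
        exact hall f h1 h2
      · rintro ⟨_, ⟨v, c, hc, hm, rfl⟩, hlt⟩
        rw [Set.Finite.csSup_lt_iff (Set.toFinite _) ((hne v c hc hm).image w)] at hlt
        exact ⟨v, c, hc, hm, fun f h1 h2 => hlt _ ⟨f, ⟨h1, h2⟩, rfl⟩⟩
    · apply ((Set.finite_range w).subset _).bddBelow
      rintro _ ⟨v, c, hc, hm, rfl⟩
      exact Set.image_subset_range _ _
        (((hne v c hc hm).image w).csSup_mem (Set.toFinite _))
    · rw [SimpleGraph.isBridge_iff_forall_cycle_notMem he] at hb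
      push Not at hb
      obtain ⟨v, c, hc, hm⟩ := hb
      exact ⟨_, v, c, hc, hm, rfl⟩
  · rw [aux_blue G hG w a b hab]
    have hne : ∀ D : Set V, s(a, b) ∈ cutEdges G D → (cutEdges G D \ {s(a, b)}).Nonempty := by
      rintro D ⟨-, x, y, hxy, hx, hy⟩
      rw [hxy] at hb ⊢
      rw [SimpleGraph.isBridge_iff, not_not] at hb
      obtain ⟨p⟩ := hb
      obtain ⟨d, hd, h1, h2⟩ := p.exists_boundary_dart D hx hy
      have := d.adj
      rw [SimpleGraph.deleteEdges_adj] at this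
      exact ⟨s(d.fst, d.snd), ⟨this.1, _, _, rfl, h1, h2⟩, this.2⟩
    rw [lt_csSup_iff]
    · constructor
      · rintro ⟨D, hD, hall⟩
        refine ⟨_, ⟨D, hD, rfl⟩, ?_⟩
        rw [Set.Finite.lt_csInf_iff (Set.toFinite _) ((hne D hD).image w)]
        rintro _ ⟨f, ⟨h1, h2⟩, rfl⟩
        exact hall f h1 h2
      · rintro ⟨_, ⟨D, hD, rfl⟩, hlt⟩
        rw [Set.Finite.lt_csInf_iff (Set.toFinite _) ((hne D hD).image w)] at hlt
        exact ⟨D, hD, fun f h1 h2 => hlt _ ⟨f, ⟨h1, h2⟩, rfl⟩⟩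
    · apply ((Set.finite_range w).subset _).bddAbove
      rintro _ ⟨D, hD, rfl⟩
      exact Set.image_subset_range _ _
        (((hne D hD).image w).csInf_mem (Set.toFinite _))
    · exact ⟨_, {a}, ⟨he, a, b, rfl, rfl, fun h => hab.ne h.symm⟩, rfl⟩
end
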